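/- Let A, B ∈ ℝ^{n×n×n₃} with A f-symmetric and B f-symmetric positive definite. Then the maximum of Trace(Uᵀ ⋆ A ⋆ U) over tensors U ∈ ℝ^{n×d×n₃} satisfying Uᵀ ⋆ B ⋆ U = I_d is attained, and any maximizer U satisfies the generalized eigentube equation A ⋆ U = B ⋆ U ⋆ L for some f-symmetric tensor L ∈ ℝ^{d×d×n₃}; moreover Uᵀ ⋆ A ⋆ U = L at the optimum. -/

import Mathlib

open Matrix Complex Finset Kronecker ComplexOrder

abbrev Tensor (n₁ n₂ n₃ : ℕ) := Fin n₃ → Matrix (Fin n₁) (Fin n₂) ℝ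

/-- The DFT along the third (tube) mode: the `i`-th Fourier frontal slice `Â⁽ⁱ⁾`. -/
noncomputable def dftSlice {n₁ n₂ n₃ : ℕ} (A : Tensor n₁ n₂ n₃) (i : Fin n₃) :
    Matrix (Fin n₁) (Fin n₂) ℂ :=
  ∑ k : Fin n₃,
    Complex.exp (-2 * Real.pi * Complex.I * ((i : ℕ) : ℂ) * ((k : ℕ) : ℂ) / (n₃ : ℂ)) •
      (A k).map Complex.ofReal

/-- The t-product `A ⋆ B = fold (bcirc A · unfold B)`, i.e. circular convolution of
frontal slices. -/
noncomputable def tProd {n₁ q n₂ n₃ : ℕ} (A : Tensor n₁ q n₃) (B : Tensor q n₂ n₃) :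
    Tensor n₁ n₂ n₃ :=
  fun k => ∑ m : Fin n₃, A m * B (k - m)

/-- Tensor transpose: transpose each frontal slice and reverse the order of slices 2..n₃. -/
def tTranspose {n₁ n₂ n₃ : ℕ} (A : Tensor n₁ n₂ n₃) : Tensor n₂ n₁ n₃ :=
  fun k => (A (-k)).transpose

/-- Identity tensor: first frontal slice is the identity matrix, the rest are zero. -/
def tId (n n₃ : ℕ) [NeZero n₃] : Tensor n n n₃ := fun k => if k = 0 then 1 else 0

/-- Tensor trace `(1/n₃) Σᵢ trace Â⁽ⁱ⁾` (complex-valued form). -/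
noncomputable def tTraceC {n n₃ : ℕ} (A : Tensor n n n₃) : ℂ :=
  (n₃ : ℂ)⁻¹ * ∑ i : Fin n₃, (dftSlice A i).trace

/-- Tensor trace (real value). -/
noncomputable def tTraceR {n n₃ : ℕ} (A : Tensor n n n₃) : ℝ := (tTraceC A).re

/-- Squared Frobenius norm of a third-order tensor. -/
def frobSq {n₁ n₂ n₃ : ℕ} (A : Tensor n₁ n₂ n₃) : ℝ :=
  ∑ k : Fin n₃, ∑ p, ∑ q, (A k p q) ^ 2

section Helpers

variable {n m d q N : ℕ}

/-- The block circulant matrix of a tensor. -/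
def bc (A : Tensor n m N) : Matrix (Fin N × Fin n) (Fin N × Fin m) ℝ :=
  Matrix.of fun i j => A (i.1 - j.1) i.2 j.2

theorem bc_tProd [NeZero N] (A : Tensor n q N) (B : Tensor q m N) :
    bc (tProd A B) = bc A * bc B := by
  ext ⟨i, p⟩ ⟨j, r⟩
  simp only [bc, tProd, Matrix.of_apply, Matrix.mul_apply, Matrix.sum_apply, Fintype.sum_prod_type]
  rw [← (Equiv.subLeft i).sum_comp]
  refine Finset.sum_congr rfl fun l _ => Finset.sum_congr rfl fun s _ => ?_
  simp only [Equiv.subLeft_apply]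
  rw [show i - j - (i - l) = l - j by abel]

theorem bc_tTranspose [NeZero N] (A : Tensor n m N) : bc (tTranspose A) = (bc A)ᵀ := by
  ext ⟨i, p⟩ ⟨j, r⟩
  simp only [bc, tTranspose, Matrix.of_apply, Matrix.transpose_apply, neg_sub]

theorem bc_tId [NeZero N] : bc (tId n N) = 1 := by
  ext ⟨i, p⟩ ⟨j, r⟩
  simp only [bc, tId, Matrix.of_apply, Matrix.one_apply, sub_eq_zero, Prod.mk.injEq]
  by_cases h : i = j <;> simp [h, Matrix.one_apply]

theorem bc_injective [NeZero N] {A B : Tensor n m N} (h : bc A = bc B) : A = B := by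
  funext k
  ext p r
  have := congrFun (congrFun h (k, p)) (0, r)
  simpa [bc] using this

theorem bc_add (A B : Tensor n m N) : bc (A + B) = bc A + bc B := by
  ext; simp [bc]

theorem bc_smul (t : ℝ) (A : Tensor n m N) : bc (t • A) = t • bc A := by
  ext; simp [bc]

theorem bc_sub (A B : Tensor n m N) : bc (A - B) = bc A - bc B := by
  ext; simp [bc]

/-- cyclic shift of the block index -/
def sh (n : ℕ) [NeZero N] (c : Fin N) : Fin N × Fin n ≃ Fin N × Fin n :=
  (Equiv.addRight c).prodCongr (Equiv.refl _)

theorem bc_shift [NeZero N] (A : Tensor n m N) (c : Fin N) :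
    (bc A).submatrix (sh n c) (sh m c) = bc A := by
  ext ⟨i, p⟩ ⟨j, r⟩
  simp [bc, sh]

theorem exists_bc [NeZero N] (M : Matrix (Fin N × Fin n) (Fin N × Fin m) ℝ)
    (h : ∀ c, M.submatrix (sh n c) (sh m c) = M) : ∃ A : Tensor n m N, bc A = M := by
  refine ⟨fun k => Matrix.of fun p r => M (k, p) (0, r), ?_⟩
  ext ⟨i, p⟩ ⟨j, r⟩
  have := congrFun (congrFun (h j) (i - j, p)) (0, r)
  simp [sh] at this
  simp [bc, this]

open MatrixOrder in
theorem exists_invsqrt [NeZero N] (P : Tensor n n N) (hP : (bc P).PosDef) :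
    ∃ R : Tensor n n N, (bc R)ᵀ = bc R ∧ bc R * bc R * bc P = 1 := by
  have hi := hP.inv.posSemidef
  have h0 : 0 ≤ CFC.sqrt (bc P)⁻¹ := CFC.sqrt_nonneg _
  have hs : CFC.sqrt (bc P)⁻¹ * CFC.sqrt (bc P)⁻¹ = (bc P)⁻¹ :=
    CFC.sqrt_mul_sqrt_self _ hi.nonneg
  obtain ⟨R, hR⟩ := exists_bc (CFC.sqrt (bc P)⁻¹) (by
    intro c
    symm
    apply CFC.sqrt_unique
    · rw [Matrix.submatrix_mul_equiv, hs, ← Matrix.inv_submatrix_equiv, bc_shift]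
    · exact (h0.posSemidef.submatrix _).nonneg)
  refine ⟨R, ?_, ?_⟩
  · rw [hR]
    simpa using h0.posSemidef.isHermitian.eq
  · rw [hR, hs]
    exact Matrix.nonsing_inv_mul _ ((Matrix.isUnit_iff_isUnit_det _).1 hP.isUnit)

/-- The root of unity of the DFT. -/
noncomputable def zt (N : ℕ) : ℂ := (Complex.exp (2 * Real.pi * Complex.I / N))⁻¹

theorem zt_prim [NeZero N] : IsPrimitiveRoot (zt N) N :=
  (Complex.isPrimitiveRoot_exp N (NeZero.ne N)).inv

theorem dftSlice_eq (A : Tensor n m N) (i : Fin N) :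
    dftSlice A i = ∑ k : Fin N, (zt N ^ (i : ℕ)) ^ (k : ℕ) • (A k).map Complex.ofReal := by
  unfold dftSlice
  refine Finset.sum_congr rfl fun k _ => ?_
  congr 1
  rw [zt, ← Complex.exp_neg, ← Complex.exp_nat_mul, ← Complex.exp_nat_mul]
  congr 1
  ring

theorem pow_val_add [NeZero N] {w : ℂ} (hw : w ^ N = 1) (a b : Fin N) :
    w ^ ((a + b : Fin N) : ℕ) = w ^ (a : ℕ) * w ^ (b : ℕ) := by
  rw [Fin.val_add, ← pow_add, ← pow_mod_orderOf, Nat.mod_mod_of_dvd _ (orderOf_dvd_of_pow_eq_one hw),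
    pow_mod_orderOf]

theorem zt_pow [NeZero N] (i : ℕ) : (zt N ^ i) ^ N = 1 := by
  rw [← pow_mul, mul_comm, pow_mul, zt_prim.pow_eq_one, one_pow]

theorem dft_tProd [NeZero N] (A : Tensor n q N) (B : Tensor q m N) (i : Fin N) :
    dftSlice (tProd A B) i = dftSlice A i * dftSlice B i := by
  simp only [dftSlice_eq]
  set w := zt N ^ (i : ℕ)
  have hw : w ^ N = 1 := zt_pow _
  rw [Matrix.sum_mul]
  have : ∀ k : Fin N, (tProd A B k).map Complex.ofReal =
      ∑ l, (A l).map Complex.ofReal * (B (k - l)).map Complex.ofReal := by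
    intro k
    ext p r
    simp [tProd, Matrix.sum_apply, Matrix.mul_apply]
  simp only [this, Finset.smul_sum, Matrix.mul_sum]
  rw [Finset.sum_comm]
  refine Finset.sum_congr rfl fun l _ => ?_
  rw [← Equiv.sum_comp (Equiv.addRight l)]
  refine Finset.sum_congr rfl fun k _ => ?_
  simp only [Equiv.coe_addRight, add_sub_cancel_right, pow_val_add hw, Matrix.smul_mul,
    Matrix.mul_smul, smul_smul]

theorem zt_star [NeZero N] (i : ℕ) : star (zt N ^ i) = (zt N ^ i)⁻¹ := by
  have h : ‖zt N ^ i‖ = 1 := Complex.norm_eq_one_of_pow_eq_one (zt_pow i) (NeZero.ne N)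
  exact (Complex.inv_eq_conj h).symm

theorem dft_tTranspose [NeZero N] (A : Tensor n m N) (i : Fin N) :
    dftSlice (tTranspose A) i = (dftSlice A i)ᴴ := by
  simp only [dftSlice_eq, Matrix.conjTranspose_sum, Matrix.conjTranspose_smul]
  rw [← Equiv.sum_comp (Equiv.neg (Fin N))]
  refine Finset.sum_congr rfl fun k _ => ?_
  have hw := zt_pow (N := N) (i : ℕ)
  rw [star_pow, zt_star]
  set w := zt N ^ (i : ℕ)
  have h2 : w ^ ((-k : Fin N) : ℕ) = w⁻¹ ^ (k : ℕ) := by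
    have h := pow_val_add hw (-k) k
    simp only [neg_add_cancel, Fin.val_zero, pow_zero] at h
    rw [inv_pow]
    exact eq_inv_of_mul_eq_one_left h.symm
  simp only [Equiv.neg_apply, h2]
  congr 1
  ext p r
  simp [tTranspose]

theorem tTraceC_eq [NeZero N] (A : Tensor n n N) : tTraceC A = ((A 0).trace : ℂ) := by
  have hN : (N : ℂ) ≠ 0 := Nat.cast_ne_zero.2 (NeZero.ne N)
  simp only [tTraceC, dftSlice_eq, Matrix.trace_sum, Matrix.trace_smul]
  rw [Finset.sum_comm, Finset.sum_eq_single 0]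
  · simp [hN, Matrix.trace]
  · intro k _ hk
    simp only [smul_eq_mul]
    rw [← Finset.sum_mul]
    have : ∑ i : Fin N, (zt N ^ (i : ℕ)) ^ (k : ℕ) = 0 := by
      simp only [← pow_mul]
      simp only [mul_comm, pow_mul]
      rw [Fin.sum_univ_eq_sum_range (fun i => (zt N ^ (k : ℕ)) ^ i) N]
      have h1 : zt N ^ (k : ℕ) ≠ 1 :=
        zt_prim.pow_ne_one_of_pos_of_lt (fun h => hk (Fin.ext (by simpa using h))) k.2
      rw [geom_sum_eq h1, zt_pow, sub_self, zero_div]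
    rw [this, zero_mul]
  · simp

theorem tTraceR_eq [NeZero N] (A : Tensor n n N) : tTraceR A = (A 0).trace := by
  rw [tTraceR, tTraceC_eq, Complex.ofReal_re]

theorem trace_bc [NeZero N] (A : Tensor n n N) : (bc A).trace = N * tTraceR A := by
  rw [tTraceR_eq]
  simp [Matrix.trace, bc, Fintype.sum_prod_type]

theorem posDef_bc [NeZero N] (B : Tensor n n N) (hB : tTranspose B = B)
    (hBpd : ∀ i : Fin N, (dftSlice B i).PosDef) : (bc B).PosDef := by
  have hN : (0:ℝ) < N := Nat.cast_pos.2 (NeZero.pos N)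
  have hNC : (N : ℂ) ≠ 0 := Nat.cast_ne_zero.2 (NeZero.ne N)
  apply Matrix.PosDef.of_dotProduct_mulVec_pos
  · have := bc_tTranspose B
    rw [hB] at this
    simpa [Matrix.IsHermitian] using this.symm
  · intro x hx
    let X : Tensor n 1 N := fun k => Matrix.of fun p _ => x (k, p)
    have key : ∀ C : Tensor n n N, ((x ⬝ᵥ (bc C *ᵥ x) : ℝ) : ℂ) =
        (N : ℂ)⁻¹ * ∑ i, ((dftSlice X i)ᴴ * dftSlice C i * dftSlice X i).trace := by
      intro C
      have h1 := tTraceC_eq (tProd (tProd (tTranspose X) C) X)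
      simp only [tTraceC, dft_tProd, dft_tTranspose] at h1
      rw [h1]
      congr 1
      have h2 : (tProd (tProd (tTranspose X) C) X) 0 0 0
          = ((bc X)ᵀ * bc C * bc X) (0, 0) (0, 0) := by
        rw [← bc_tTranspose, ← bc_tProd, ← bc_tProd]
        simp [bc]
      simp only [Matrix.trace, Matrix.diag_apply, Finset.univ_unique, Fin.default_eq_zero,
        Finset.sum_singleton]
      rw [h2, Matrix.mul_assoc]
      simp only [Matrix.mul_apply (M := (bc X)ᵀ), dotProduct]
      refine Finset.sum_congr rfl fun a _ => ?_
      congr 1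
      · simp [bc, X]
      · simp [Matrix.mul_apply, Matrix.mulVec, dotProduct, bc, X]
    have hXne : ∃ i, dftSlice X i ≠ 0 := by
      by_contra! hcon
      have h := key (tId n N)
      simp only [hcon, bc_tId, Matrix.one_mulVec] at h
      simp at h
      exact hx h
    have hnn : ∀ i, 0 ≤ ((dftSlice X i)ᴴ * dftSlice B i * dftSlice X i).trace := fun i =>
      ((hBpd i).posSemidef.conjTranspose_mul_mul_same _).trace_nonneg
    obtain ⟨i, hi⟩ := hXne
    have hpos : 0 < ((dftSlice X i)ᴴ * dftSlice B i * dftSlice X i).trace := by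
      simp only [Matrix.trace, Matrix.diag_apply, Finset.univ_unique, Fin.default_eq_zero,
        Finset.sum_singleton]
      have hv : (fun p => dftSlice X i p 0) ≠ 0 := by
        intro h0
        apply hi
        ext p r
        have := congrFun h0 p
        rw [Subsingleton.elim r 0]
        simpa using this
      have := (hBpd i).dotProduct_mulVec_pos hv
      rw [Matrix.mul_assoc]
      simpa [Matrix.mul_apply, Matrix.mulVec, dotProduct] using this
    have hs : 0 < ∑ i, ((dftSlice X i)ᴴ * dftSlice B i * dftSlice X i).trace :=
      Finset.sum_pos' (fun i _ => hnn i) ⟨i, Finset.mem_univ _, hpos⟩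
    have hfin : (0 : ℂ) < ((x ⬝ᵥ (bc B *ᵥ x) : ℝ) : ℂ) := by
      rw [key B]
      refine mul_pos ?_ hs
      have : (0 : ℂ) < ((N : ℝ)⁻¹ : ℝ) := by
        exact_mod_cast inv_pos.2 hN
      simpa using this
    simpa using (Complex.zero_lt_real.1 hfin)

theorem feasible_iff [NeZero N] (B : Tensor n n N) (U : Tensor n d N) :
    tProd (tProd (tTranspose U) B) U = tId d N ↔ (bc U)ᵀ * bc B * bc U = 1 := by
  rw [← bc_tTranspose, ← bc_tProd, ← bc_tProd, ← bc_tId]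
  exact ⟨fun h => by rw [h], bc_injective⟩

theorem continuous_tProd {X : Type*} [TopologicalSpace X] {f : X → Tensor n q N}
    {g : X → Tensor q m N} (hf : Continuous f) (hg : Continuous g) :
    Continuous fun x => tProd (f x) (g x) := by
  unfold tProd
  refine continuous_pi fun k => continuous_finsetSum _ fun l _ => ?_
  exact ((continuous_apply l).comp hf).matrix_mul ((continuous_apply (k - l)).comp hg)

theorem continuous_tTranspose {X : Type*} [TopologicalSpace X] {f : X → Tensor n m N}
    (hf : Continuous f) : Continuous fun x => tTranspose (f x) := by
  unfold tTranspose
  refine continuous_pi fun k => ?_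
  exact ((continuous_apply (-k)).comp hf).matrix_transpose

theorem continuous_tTraceR [NeZero N] {X : Type*} [TopologicalSpace X] {f : X → Tensor n n N}
    (hf : Continuous f) : Continuous fun x => tTraceR (f x) := by
  simp only [tTraceR_eq]
  exact ((continuous_apply 0).comp hf).matrix_trace

theorem compact_stiefel [NeZero N] :
    IsCompact {W : Tensor n d N | tProd (tTranspose W) W = tId d N} := by
  have hc : IsCompact (Set.pi Set.univ fun _ : Fin N => Set.pi Set.univ fun _ : Fin n =>
      Set.pi Set.univ fun _ : Fin d => Set.Icc (-1 : ℝ) 1) :=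
    isCompact_univ_pi fun _ => isCompact_univ_pi fun _ => isCompact_univ_pi fun _ => isCompact_Icc
  refine IsCompact.of_isClosed_subset hc ?_ ?_
  · exact isClosed_eq (continuous_tProd (continuous_tTranspose continuous_id) continuous_id)
      continuous_const
  · intro W hW
    have hW' : (bc W)ᵀ * bc W = 1 := by
      rw [← bc_tTranspose, ← bc_tProd, hW, bc_tId]
    intro k _ p _ r _
    have h := congrFun (congrFun hW' (0, r)) (0, r)
    rw [Matrix.one_apply_eq, Matrix.mul_apply] at h
    have h2 : (W k p r) * (W k p r) ≤ 1 := by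
      rw [← h]
      have := Finset.single_le_sum (f := fun a => (bc W)ᵀ (0, r) a * bc W a (0, r))
        (fun a _ => mul_self_nonneg _) (Finset.mem_univ (k, p))
      simpa [bc] using this
    exact ⟨by nlinarith, by nlinarith⟩

theorem stiefel_nonempty [NeZero N] (hd : d ≤ n) :
    ∃ W : Tensor n d N, tProd (tTranspose W) W = tId d N := by
  let W : Tensor n d N := fun k => (tId n N k).submatrix id (Fin.castLE hd)
  refine ⟨W, bc_injective ?_⟩
  have hW : bc W = (1 : Matrix (Fin N × Fin n) (Fin N × Fin n) ℝ).submatrix id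
      (Prod.map id (Fin.castLE hd)) := by
    rw [← bc_tId]
    ext ⟨i, p⟩ ⟨j, r⟩
    simp [bc, W]
  rw [bc_tProd, bc_tTranspose, hW, bc_tId, Matrix.transpose_submatrix, Matrix.transpose_one]
  have h2 := Matrix.submatrix_mul_equiv (1 : Matrix (Fin N × Fin n) (Fin N × Fin n) ℝ)
    (1 : Matrix (Fin N × Fin n) (Fin N × Fin n) ℝ) (Prod.map id (Fin.castLE hd))
      (Equiv.refl _) (Prod.map (id : Fin N → Fin N) (Fin.castLE hd))
  rw [Equiv.coe_refl] at h2
  rw [h2, Matrix.mul_one]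
  exact Matrix.submatrix_one _ (Function.injective_id.prodMap (Fin.castLE_injective hd))

theorem exists_max [NeZero N] (A B C : Tensor n n N) (hB : (bc B)ᵀ = bc B)
    (hC : (bc C)ᵀ = bc C) (hCB : bc C * bc C * bc B = 1) (hd : d ≤ n) :
    ∃ U : Tensor n d N, tProd (tProd (tTranspose U) B) U = tId d N ∧
      ∀ U' : Tensor n d N, tProd (tProd (tTranspose U') B) U' = tId d N →
        tTraceR (tProd (tProd (tTranspose U') A) U') ≤
          tTraceR (tProd (tProd (tTranspose U) A) U) := by
  have hCBC : bc C * bc B * bc C = 1 := by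
    rw [Matrix.mul_assoc] at hCB
    exact mul_eq_one_comm.1 hCB
  have hBCC : bc B * (bc C * bc C) = 1 := mul_eq_one_comm.1 hCB
  have hcont : Continuous fun W : Tensor n d N =>
      tTraceR (tProd (tProd (tTranspose (tProd C W)) A) (tProd C W)) := by
    have h1 : Continuous fun W : Tensor n d N => tProd C W :=
      continuous_tProd continuous_const continuous_id
    exact continuous_tTraceR (continuous_tProd (continuous_tProd (continuous_tTranspose h1)
      continuous_const) h1)
  obtain ⟨W, hW, hmax⟩ := (compact_stiefel (n := n) (d := d) (N := N)).exists_isMaxOn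
    (stiefel_nonempty hd) hcont.continuousOn
  refine ⟨tProd C W, ?_, ?_⟩
  · have hW' : (bc W)ᵀ * bc W = 1 := by
      rw [← bc_tTranspose, ← bc_tProd, hW, bc_tId]
    rw [feasible_iff, bc_tProd, Matrix.transpose_mul, hC]
    calc (bc W)ᵀ * bc C * bc B * (bc C * bc W) = (bc W)ᵀ * (bc C * bc B * bc C) * bc W := by
          simp only [Matrix.mul_assoc]
      _ = 1 := by rw [hCBC, Matrix.mul_one, hW']
  · intro U' hU'
    rw [feasible_iff] at hU'
    have hmem : tProd (tTranspose (tProd (tProd C B) U')) (tProd (tProd C B) U') = tId d N := by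
      apply bc_injective
      simp only [bc_tProd, bc_tTranspose, bc_tId, Matrix.transpose_mul, hB, hC]
      calc (bc U')ᵀ * (bc B * bc C) * (bc C * bc B * bc U')
          = (bc U')ᵀ * ((bc B * (bc C * bc C)) * bc B) * bc U' := by
            simp only [Matrix.mul_assoc]
        _ = 1 := by rw [hBCC, Matrix.one_mul, hU']
    have := hmax hmem
    have he : tProd C (tProd (tProd C B) U') = U' := by
      apply bc_injective
      simp only [bc_tProd]
      rw [← Matrix.mul_assoc, ← Matrix.mul_assoc, hCB, Matrix.one_mul]
    simpa [he] using this

theorem stationarity [NeZero N] (A B C : Tensor n n N) (hA : (bc A)ᵀ = bc A)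
    (hB : (bc B)ᵀ = bc B)
    (hC : (bc C)ᵀ = bc C) (hCB : bc C * bc C * bc B = 1) (U : Tensor n d N)
    (hU : (bc U)ᵀ * bc B * bc U = 1)
    (hmax : ∀ U' : Tensor n d N, (bc U')ᵀ * bc B * bc U' = 1 →
      ((bc U')ᵀ * bc A * bc U').trace ≤ ((bc U)ᵀ * bc A * bc U).trace) :
    bc A * bc U = bc B * bc U * ((bc U)ᵀ * bc A * bc U) := by
  have hBCC : bc B * (bc C * bc C) = 1 := mul_eq_one_comm.1 hCB
  let L := tProd (tProd (tTranspose U) A) U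
  let G := tProd A U - tProd (tProd B U) L
  let V := tProd (tProd C C) G
  have hL : bc L = (bc U)ᵀ * bc A * bc U := by simp only [L, bc_tProd, bc_tTranspose]
  have hG : bc G = bc A * bc U - bc B * bc U * bc L := by simp only [G, bc_sub, bc_tProd]
  have hV : bc V = bc C * bc C * bc G := by simp only [V, bc_tProd]
  have hLt : (bc L)ᵀ = bc L := by
    rw [hL]; simp only [Matrix.transpose_mul, hA, Matrix.transpose_transpose, Matrix.mul_assoc]
  have hUG : (bc U)ᵀ * bc G = 0 := by
    rw [hG, Matrix.mul_sub, ← Matrix.mul_assoc, ← Matrix.mul_assoc, ← Matrix.mul_assoc, hU,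
      Matrix.one_mul, hL, sub_self]
  have hBV : bc B * bc V = bc G := by
    rw [hV, ← Matrix.mul_assoc, hBCC, Matrix.one_mul]
  have hUBV : (bc U)ᵀ * bc B * bc V = 0 := by rw [Matrix.mul_assoc, hBV, hUG]
  have hVBU : (bc V)ᵀ * bc B * bc U = 0 := by
    have := congrArg Matrix.transpose hUBV
    simpa [Matrix.transpose_mul, hB, Matrix.mul_assoc] using this
  have hVG : (bc V)ᵀ * bc G = (bc C * bc G)ᵀ * (bc C * bc G) := by
    rw [hV]; simp only [Matrix.transpose_mul, hC, Matrix.mul_assoc]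
  -- trace of the first-order term
  have htr1 : ((bc V)ᵀ * bc A * bc U).trace = ((bc C * bc G)ᵀ * (bc C * bc G)).trace := by
    have : bc A * bc U = bc G + bc B * bc U * bc L := by rw [hG]; abel
    rw [Matrix.mul_assoc, this, Matrix.mul_add, hVG, ← Matrix.mul_assoc (bc V)ᵀ,
      ← Matrix.mul_assoc (bc V)ᵀ, hVBU, Matrix.zero_mul, add_zero]
  have htr2 : ((bc U)ᵀ * bc A * bc V).trace = ((bc V)ᵀ * bc A * bc U).trace := by
    rw [← Matrix.trace_transpose]
    simp only [Matrix.transpose_mul, hA, Matrix.transpose_transpose, Matrix.mul_assoc]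
  set M := (bc V)ᵀ * bc B * bc V with hM
  have hMpsd : M.PosSemidef := by
    have : M = (bc C * bc G)ᴴ * (bc C * bc G) := by
      rw [hM, Matrix.mul_assoc, hBV, hVG, Matrix.conjTranspose_eq_transpose_of_trivial]
    rw [this]
    exact Matrix.posSemidef_conjTranspose_mul_self _
  have hPpd : ∀ t : ℝ, (1 + t ^ 2 • M).PosDef := fun t =>
    Matrix.PosDef.one.add_posSemidef (hMpsd.smul (sq_nonneg t))
  set K := (bc V)ᵀ * bc A * bc U + (bc U)ᵀ * bc A * bc V with hK
  set Q := (bc V)ᵀ * bc A * bc V with hQ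
  let Nn : ℝ → Matrix (Fin N × Fin d) (Fin N × Fin d) ℝ := fun t => (1 + t ^ 2 • M)⁻¹
  have hdet : ∀ t, IsUnit (1 + t ^ 2 • M).det := fun t =>
    (Matrix.isUnit_iff_isUnit_det _).1 (hPpd t).isUnit
  have hineq : ∀ t : ℝ, ((bc L + t • K + t ^ 2 • Q) * Nn t).trace ≤ (bc L).trace := by
    intro t
    let Ut : Tensor n d N := U + t • V
    have hUt : bc Ut = bc U + t • bc V := by simp only [Ut, bc_add, bc_smul]
    let P := tProd (tProd (tTranspose Ut) B) Ut
    have hP : bc P = 1 + t ^ 2 • M := by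
      simp only [P, bc_tProd, bc_tTranspose, hUt, Matrix.transpose_add, Matrix.transpose_smul,
        Matrix.add_mul, Matrix.mul_add, Matrix.smul_mul, Matrix.mul_smul, hU, hUBV, hVBU,
        smul_zero, zero_add, add_zero]
      rw [smul_smul, ← pow_two]
    have hQt : (bc Ut)ᵀ * bc A * bc Ut = bc L + t • K + t ^ 2 • Q := by
      simp only [hUt, Matrix.transpose_add, Matrix.transpose_smul,
        Matrix.add_mul, Matrix.mul_add, Matrix.smul_mul, Matrix.mul_smul, hL, hK, hQ, smul_add]
      rw [smul_smul, ← pow_two]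
      abel
    obtain ⟨R, hRt, hRP⟩ := exists_invsqrt P (by rw [hP]; exact hPpd t)
    have hRPR : bc R * bc P * bc R = 1 := by
      rw [Matrix.mul_assoc] at hRP
      exact mul_eq_one_comm.1 hRP
    have hRR : bc R * bc R = Nn t := by
      simp only [Nn]
      rw [← hP]
      exact (Matrix.inv_eq_left_inv hRP).symm
    have hfe := hmax (tProd Ut R) (by
      rw [← hRPR]
      simp only [P, bc_tProd, bc_tTranspose, Matrix.transpose_mul, hRt, Matrix.mul_assoc])
    rw [← hL] at hfe
    refine le_trans (le_of_eq ?_) hfe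
    rw [← hQt, ← hRR, ← Matrix.mul_assoc, Matrix.trace_mul_comm, bc_tProd, Matrix.transpose_mul,
      hRt]
    simp only [Matrix.mul_assoc]
  have hN1 : ∀ t, Nn t = 1 - t ^ 2 • (M * Nn t) := by
    intro t
    have h := Matrix.mul_nonsing_inv _ (hdet t)
    rw [Matrix.add_mul, Matrix.one_mul, Matrix.smul_mul] at h
    exact eq_sub_of_add_eq h
  let g : ℝ → ℝ := fun t => (K * Nn t).trace + t * ((Q * Nn t).trace - (bc L * (M * Nn t)).trace)
  have hfg : ∀ t, ((bc L + t • K + t ^ 2 • Q) * Nn t).trace = (bc L).trace + t * g t := by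
    intro t
    have h1 : (bc L * Nn t).trace = (bc L).trace - t ^ 2 * (bc L * (M * Nn t)).trace := by
      conv_lhs => rw [hN1 t]
      rw [Matrix.mul_sub, Matrix.mul_one, Matrix.trace_sub, Matrix.mul_smul, Matrix.trace_smul,
        smul_eq_mul]
    simp only [Matrix.add_mul, Matrix.trace_add, Matrix.smul_mul, Matrix.trace_smul, smul_eq_mul,
      h1, g]
    ring
  have hcN : Continuous Nn := by
    have : Nn = fun t => (1 + t ^ 2 • M).det⁻¹ • (1 + t ^ 2 • M).adjugate := by
      funext t
      simp only [Nn, Matrix.inv_def, Ring.inverse_eq_inv']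
    rw [this]
    have hc : Continuous fun t : ℝ => 1 + t ^ 2 • M := by fun_prop
    exact (hc.matrix_det.inv₀ fun t => (hdet t).ne_zero).smul hc.matrix_adjugate
  have hcg : Continuous g := by
    have a1 := (continuous_const (y := K)).matrix_mul hcN
    have a2 := (continuous_const (y := Q)).matrix_mul hcN
    have a3 := (continuous_const (y := bc L)).matrix_mul ((continuous_const (y := M)).matrix_mul hcN)
    exact a1.matrix_trace.add (continuous_id.mul (a2.matrix_trace.sub a3.matrix_trace))
  have hg0 : g 0 ≤ 0 := by
    have hlim : Filter.Tendsto g (nhdsWithin 0 (Set.Ioi 0)) (nhds (g 0)) :=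
      hcg.continuousAt.tendsto.mono_left nhdsWithin_le_nhds
    refine le_of_tendsto hlim ?_
    filter_upwards [self_mem_nhdsWithin] with t ht
    have h := hineq t
    rw [hfg] at h
    have ht' : 0 < t := ht
    by_contra! hc
    have := mul_pos ht' hc
    linarith
  have hg0' : g 0 = 2 * ((bc C * bc G)ᵀ * (bc C * bc G)).trace := by
    simp [g, Nn, hK, Matrix.trace_add, htr2, htr1]
    ring
  have hz : ((bc C * bc G)ᴴ * (bc C * bc G)).trace = 0 := by
    have h1 := (Matrix.posSemidef_conjTranspose_mul_self (bc C * bc G)).trace_nonneg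
    rw [Matrix.conjTranspose_eq_transpose_of_trivial] at h1 ⊢
    linarith
  rw [Matrix.trace_conjTranspose_mul_self_eq_zero_iff] at hz
  have hG0 : bc G = 0 := by
    rw [← hBV, hV, Matrix.mul_assoc, hz, Matrix.mul_zero, Matrix.mul_zero]
  rw [hG, sub_eq_zero] at hG0
  rw [hG0, hL]

end Helpers

/-- Existence of a maximizer of `Trace (Uᵀ⋆A⋆U)` under the constraint
`Uᵀ⋆B⋆U = I_d`, and the generalized eigentube equation satisfied at any maximizer. -/
theorem trace_max_constrained_and_eigentube {n d n₃ : ℕ} [NeZero n₃]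
    (A B : Tensor n n n₃) (hA : tTranspose A = A) (hB : tTranspose B = B)
    (hBpd : ∀ i : Fin n₃, (dftSlice B i).PosDef) (hd : d ≤ n) :
    (∃ U : Tensor n d n₃, tProd (tProd (tTranspose U) B) U = tId d n₃ ∧
      ∀ U' : Tensor n d n₃, tProd (tProd (tTranspose U') B) U' = tId d n₃ →
        tTraceR (tProd (tProd (tTranspose U') A) U') ≤
          tTraceR (tProd (tProd (tTranspose U) A) U)) ∧
    ∀ U : Tensor n d n₃, tProd (tProd (tTranspose U) B) U = tId d n₃ →
      (∀ U' : Tensor n d n₃, tProd (tProd (tTranspose U') B) U' = tId d n₃ →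
        tTraceR (tProd (tProd (tTranspose U') A) U') ≤
          tTraceR (tProd (tProd (tTranspose U) A) U)) →
      ∃ L : Tensor d d n₃, tTranspose L = L ∧
        tProd A U = tProd (tProd B U) L ∧
        tProd (tProd (tTranspose U) A) U = L := by
  have hpd := posDef_bc B hB hBpd
  have hA' : (bc A)ᵀ = bc A := by rw [← bc_tTranspose, hA]
  have hB' : (bc B)ᵀ = bc B := by rw [← bc_tTranspose, hB]
  obtain ⟨C, hC, hCB⟩ := exists_invsqrt B hpd
  refine ⟨exists_max A B C hB' hC hCB hd, ?_⟩
  intro U hU hmax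
  have hN : (0 : ℝ) < n₃ := Nat.cast_pos.2 (NeZero.pos n₃)
  have hst := stationarity A B C hA' hB' hC hCB U ((feasible_iff B U).1 hU) (by
    intro U' hU'
    have h := hmax U' ((feasible_iff B U').2 hU')
    have h2 := mul_le_mul_of_nonneg_left h hN.le
    rw [← trace_bc, ← trace_bc] at h2
    simpa only [bc_tProd, bc_tTranspose] using h2)
  refine ⟨tProd (tProd (tTranspose U) A) U, ?_, ?_, rfl⟩
  · apply bc_injective
    simp only [bc_tProd, bc_tTranspose, Matrix.transpose_mul, hA', Matrix.transpose_transpose,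
      Matrix.mul_assoc]
  · apply bc_injective
    simpa only [bc_tProd, bc_tTranspose] using hst
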